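/- arXiv:2402.09802 — 7 statements merged into one kernel-verified Lean document; each statement's English description precedes it below -/
import Mathlib

section
/- Suppose ρ : ℝ → ℝ is non-decreasing and for every h ∈ H the function θ ↦ θ + E[ρ(L01(h) − θ)] attains its minimum on ℝ. Then for any h1, h2 ∈ H, err(h1) ≤ err(h2) implies C_ρ(L01(h1)) ≤ C_ρ(L01(h2)). If moreover ρ is strictly increasing, then err(h1) < err(h2) implies C_ρ(L01(h1)) < C_ρ(L01(h2)). -/
open MeasureTheory Set
open scoped Classical

/-- The expectation of a function of an indicator is affine in the probability of the event. -/
lemma integral_comp_indicator_one_sub {Ω : Type*} [MeasurableSpace Ω]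
    (μ : Measure Ω) [IsProbabilityMeasure μ] {A : Set Ω} (hA : MeasurableSet A)
    (ρ : ℝ → ℝ) (θ : ℝ) :
    ∫ ω, ρ (A.indicator (fun _ => (1 : ℝ)) ω - θ) ∂μ =
      ρ (-θ) + μ.real A * (ρ (1 - θ) - ρ (-θ)) := by
  have hfun : (fun ω => ρ (A.indicator (fun _ => (1 : ℝ)) ω - θ)) =
      fun ω => ρ (-θ) + A.indicator (fun _ => ρ (1 - θ) - ρ (-θ)) ω := by
    funext ω
    by_cases hω : ω ∈ A <;> simp [hω]
  rw [hfun, integral_add (integrable_const _) ((integrable_const _).indicator hA),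
    integral_indicator_const _ hA]
  simp

/-- Monotonicity of the OCE-like criterion `C_ρ` in the error probability under
the zero-one loss: if `ρ` is non-decreasing (and the inner minimum is attained),
then `err h₁ ≤ err h₂` implies `C_ρ(L01(h₁)) ≤ C_ρ(L01(h₂))`; if moreover `ρ`
is strictly increasing then the implication holds with strict inequalities. -/
theorem oce_like_monotone_zero_one
    {Ω 𝒳 𝒴 : Type*} [MeasurableSpace Ω]
    (μ : Measure Ω) [IsProbabilityMeasure μ]
    (X : Ω → 𝒳) (Y : Ω → 𝒴)
    (H : Set (𝒳 → 𝒴))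
    (hmeas : ∀ h ∈ H, MeasurableSet {ω | h (X ω) ≠ Y ω})
    (L01 : (𝒳 → 𝒴) → Ω → ℝ)
    (hL01 : ∀ h : 𝒳 → 𝒴, ∀ ω : Ω, L01 h ω = if h (X ω) ≠ Y ω then 1 else 0)
    (err : (𝒳 → 𝒴) → ℝ)
    (herr : ∀ h : 𝒳 → 𝒴, err h = (μ {ω | h (X ω) ≠ Y ω}).toReal)
    (ρ : ℝ → ℝ) (hρ : Monotone ρ)
    (hattain : ∀ h ∈ H, ∃ θ₀ : ℝ, ∀ θ : ℝ,
      θ₀ + ∫ ω, ρ (L01 h ω - θ₀) ∂μ ≤ θ + ∫ ω, ρ (L01 h ω - θ) ∂μ)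
    (Crho : (Ω → ℝ) → ℝ)
    (hCrho : ∀ L : Ω → ℝ, Crho L = ⨅ θ : ℝ, θ + ∫ ω, ρ (L ω - θ) ∂μ) :
    ∀ h₁ ∈ H, ∀ h₂ ∈ H,
      (err h₁ ≤ err h₂ → Crho (L01 h₁) ≤ Crho (L01 h₂)) ∧
      (StrictMono ρ → err h₁ < err h₂ → Crho (L01 h₁) < Crho (L01 h₂)) := by
  have hint : ∀ h ∈ H, ∀ θ : ℝ,
      ∫ ω, ρ (L01 h ω - θ) ∂μ = ρ (-θ) + err h * (ρ (1 - θ) - ρ (-θ)) := by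
    intro h hh θ
    have hL : L01 h = {ω | h (X ω) ≠ Y ω}.indicator (fun _ => (1 : ℝ)) := by
      funext ω
      rw [hL01]
      by_cases hω : h (X ω) = Y ω <;> simp [hω]
    rw [hL, integral_comp_indicator_one_sub μ (hmeas h hh), herr, measureReal_def]
  intro h₁ hh₁ h₂ hh₂
  obtain ⟨θ₁, hθ₁⟩ := hattain h₁ hh₁
  obtain ⟨θ₂, hθ₂⟩ := hattain h₂ hh₂
  have hle : Crho (L01 h₁) ≤ θ₂ + ∫ ω, ρ (L01 h₁ ω - θ₂) ∂μ := by
    rw [hCrho]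
    exact ciInf_le ⟨_, forall_mem_range.2 hθ₁⟩ θ₂
  have hge : θ₂ + ∫ ω, ρ (L01 h₂ ω - θ₂) ∂μ ≤ Crho (L01 h₂) := by
    rw [hCrho]
    exact le_ciInf hθ₂
  rw [hint h₁ hh₁] at hle
  rw [hint h₂ hh₂] at hge
  refine ⟨fun herr_le => ?_, fun hstrict herr_lt => ?_⟩
  · have hmono : ρ (-θ₂) ≤ ρ (1 - θ₂) := hρ (by linarith)
    have := mul_le_mul_of_nonneg_right herr_le (sub_nonneg.2 hmono)
    linarith
  · have hmono : ρ (-θ₂) < ρ (1 - θ₂) := hstrict (by linarith)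
    have := mul_lt_mul_of_pos_right herr_lt (sub_pos.2 hmono)
    linarith
end

section
/- Suppose ρ : ℝ → ℝ is non-decreasing and for every h ∈ H the function θ ↦ θ + E[ρ(L01(h) − θ)] attains its minimum on ℝ. Then every error-probability minimizer minimizes the criterion under the zero-one loss: Herr ⊂ argmin_{h ∈ H} C_ρ(L01(h)). -/
open MeasureTheory Set
open scoped Classical

/-- The integral of a function of a shifted zero-one indicator is affine in the probability of the
event. -/
theorem integral_comp_ite_sub {Ω : Type*} [MeasurableSpace Ω]
    (μ : Measure Ω) [IsProbabilityMeasure μ] {p : Ω → Prop} [DecidablePred p]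
    (hp : MeasurableSet {ω | p ω})
    (ρ : ℝ → ℝ) (θ : ℝ) :
    ∫ ω, ρ ((if p ω then 1 else 0) - θ) ∂μ
      = ρ (-θ) + μ.real {ω | p ω} * (ρ (1 - θ) - ρ (-θ)) := by
  have h : ∀ ω, ρ ((if p ω then 1 else 0) - θ)
      = ρ (-θ) + {ω | p ω}.indicator (fun _ => ρ (1 - θ) - ρ (-θ)) ω := by
    intro ω
    by_cases hω : p ω <;> simp [hω]
  simp_rw [h]
  rw [integral_add (integrable_const _) ((integrable_const _).indicator hp),
    integral_indicator_const _ hp]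
  simp

/-- Criterion collapse for OCE-like criteria with non-decreasing `ρ`:
error-probability minimizers in `H` minimize `C_ρ` under the zero-one loss. -/
theorem oce_like_collapse_zero_one
    {Ω 𝒳 𝒴 : Type*} [MeasurableSpace Ω]
    (μ : Measure Ω) [IsProbabilityMeasure μ]
    (X : Ω → 𝒳) (Y : Ω → 𝒴)
    (H : Set (𝒳 → 𝒴))
    (hmeas : ∀ h ∈ H, MeasurableSet {ω | h (X ω) ≠ Y ω})
    (L01 : (𝒳 → 𝒴) → Ω → ℝ)
    (hL01 : ∀ h : 𝒳 → 𝒴, ∀ ω : Ω, L01 h ω = if h (X ω) ≠ Y ω then 1 else 0)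
    (err : (𝒳 → 𝒴) → ℝ)
    (herr : ∀ h : 𝒳 → 𝒴, err h = (μ {ω | h (X ω) ≠ Y ω}).toReal)
    (ρ : ℝ → ℝ) (hρ : Monotone ρ)
    (hattain : ∀ h ∈ H, ∃ θ₀ : ℝ, ∀ θ : ℝ,
      θ₀ + ∫ ω, ρ (L01 h ω - θ₀) ∂μ ≤ θ + ∫ ω, ρ (L01 h ω - θ) ∂μ)
    (Crho : (Ω → ℝ) → ℝ)
    (hCrho : ∀ L : Ω → ℝ, Crho L = ⨅ θ : ℝ, θ + ∫ ω, ρ (L ω - θ) ∂μ) :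
    ∀ h₀ ∈ H, (∀ h ∈ H, err h₀ ≤ err h) →
      ∀ h ∈ H, Crho (L01 h₀) ≤ Crho (L01 h) := by
  intro h₀ hh₀ hmin h hh
  have hint : ∀ g ∈ H, ∀ θ : ℝ, ∫ ω, ρ (L01 g ω - θ) ∂μ
      = ρ (-θ) + err g * (ρ (1 - θ) - ρ (-θ)) := by
    intro g hg θ
    simp_rw [hL01, herr]
    exact integral_comp_ite_sub μ (hmeas g hg) ρ θ
  rw [hCrho, hCrho]
  obtain ⟨θ₀, hθ₀⟩ := hattain h₀ hh₀
  refine ciInf_mono ⟨_, forall_mem_range.2 hθ₀⟩ fun θ => ?_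
  rw [hint h₀ hh₀, hint h hh]
  have hd : 0 ≤ ρ (1 - θ) - ρ (-θ) := sub_nonneg.2 (hρ (by linarith))
  gcongr
  exact hmin h hh
end

section
/- Suppose ρ : ℝ → ℝ is strictly increasing and for every h ∈ H the function θ ↦ θ + E[ρ(L01(h) − θ)] attains its minimum on ℝ. Then the criterion minimizers coincide exactly with the error-probability minimizers: argmin_{h ∈ H} C_ρ(L01(h)) = Herr. -/
open MeasureTheory Set
open scoped Classical

/-- The expectation of a function of the indicator of a measurable set, shifted by `θ`. -/
lemma integral_comp_indicator_sub {Ω : Type*} [MeasurableSpace Ω]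
    (μ : MeasureTheory.Measure Ω) [MeasureTheory.IsProbabilityMeasure μ] {s : Set Ω}
    (hs : MeasurableSet s) {L : Ω → ℝ} (hL : ∀ ω, L ω = if ω ∈ s then 1 else 0)
    (ρ : ℝ → ℝ) (θ : ℝ) :
    ∫ ω, ρ (L ω - θ) ∂μ = ρ (-θ) + (μ s).toReal * (ρ (1 - θ) - ρ (-θ)) := by
  have hfun : (fun ω => ρ (L ω - θ)) =
      fun ω => ρ (-θ) + s.indicator (fun _ => ρ (1 - θ) - ρ (-θ)) ω := by
    funext ω
    by_cases hω : ω ∈ s <;> simp [hL, hω]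
  rw [hfun, MeasureTheory.integral_add (MeasureTheory.integrable_const _)
    ((MeasureTheory.integrable_const _).indicator hs),
    MeasureTheory.integral_indicator_const _ hs]
  simp [MeasureTheory.measureReal_def]

/-- An attained infimum of a real-valued function equals the attained value. -/
lemma ciInf_eq_of_forall_ge {ι : Type*} {f : ι → ℝ} {i : ι} (hi : ∀ j, f i ≤ f j) :
    ⨅ j, f j = f i :=
  haveI : Nonempty ι := ⟨i⟩
  le_antisymm (ciInf_le ⟨f i, Set.forall_mem_range.2 hi⟩ i) (le_ciInf hi)

/-- For strictly increasing `ρ`, the minimizers of the OCE-like criterion `C_ρ`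
under the zero-one loss coincide exactly with the error-probability minimizers. -/
theorem oce_like_coincide_zero_one
    {Ω 𝒳 𝒴 : Type*} [MeasurableSpace Ω]
    (μ : Measure Ω) [IsProbabilityMeasure μ]
    (X : Ω → 𝒳) (Y : Ω → 𝒴)
    (H : Set (𝒳 → 𝒴))
    (hmeas : ∀ h ∈ H, MeasurableSet {ω | h (X ω) ≠ Y ω})
    (L01 : (𝒳 → 𝒴) → Ω → ℝ)
    (hL01 : ∀ h : 𝒳 → 𝒴, ∀ ω : Ω, L01 h ω = if h (X ω) ≠ Y ω then 1 else 0)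
    (err : (𝒳 → 𝒴) → ℝ)
    (herr : ∀ h : 𝒳 → 𝒴, err h = (μ {ω | h (X ω) ≠ Y ω}).toReal)
    (ρ : ℝ → ℝ) (hρ : StrictMono ρ)
    (hattain : ∀ h ∈ H, ∃ θ₀ : ℝ, ∀ θ : ℝ,
      θ₀ + ∫ ω, ρ (L01 h ω - θ₀) ∂μ ≤ θ + ∫ ω, ρ (L01 h ω - θ) ∂μ)
    (Crho : (Ω → ℝ) → ℝ)
    (hCrho : ∀ L : Ω → ℝ, Crho L = ⨅ θ : ℝ, θ + ∫ ω, ρ (L ω - θ) ∂μ) :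
    {h ∈ H | ∀ h' ∈ H, Crho (L01 h) ≤ Crho (L01 h')}
      = {h ∈ H | ∀ h' ∈ H, err h ≤ err h'} := by
  have hint : ∀ h ∈ H, ∀ θ : ℝ,
      ∫ ω, ρ (L01 h ω - θ) ∂μ = ρ (-θ) + err h * (ρ (1 - θ) - ρ (-θ)) := fun h hh θ => by
    rw [herr]
    exact integral_comp_indicator_sub μ (hmeas h hh) (fun ω => by simp [hL01]) ρ θ
  have hmin : ∀ h ∈ H, ∃ θ₀ : ℝ,
      Crho (L01 h) = θ₀ + (ρ (-θ₀) + err h * (ρ (1 - θ₀) - ρ (-θ₀))) ∧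
      ∀ θ : ℝ, Crho (L01 h) ≤ θ + (ρ (-θ) + err h * (ρ (1 - θ) - ρ (-θ))) := by
    intro h hh
    obtain ⟨θ₀, hθ₀⟩ := hattain h hh
    have hC : Crho (L01 h) = θ₀ + ∫ ω, ρ (L01 h ω - θ₀) ∂μ :=
      (hCrho _).trans (ciInf_eq_of_forall_ge hθ₀)
    refine ⟨θ₀, by rw [hC, hint h hh], fun θ => ?_⟩
    rw [hC, ← hint h hh]
    exact hθ₀ θ
  have hgap (θ : ℝ) : 0 < ρ (1 - θ) - ρ (-θ) := sub_pos.2 (hρ (by linarith))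
  have hmono : ∀ h ∈ H, ∀ h' ∈ H, err h ≤ err h' → Crho (L01 h) ≤ Crho (L01 h') := by
    intro h hh h' hh' hle
    obtain ⟨-, -, hlb⟩ := hmin h hh
    obtain ⟨θ, hθ, -⟩ := hmin h' hh'
    linarith [hlb θ, mul_le_mul_of_nonneg_right hle (hgap θ).le]
  have hstrict : ∀ h ∈ H, ∀ h' ∈ H, err h < err h' → Crho (L01 h) < Crho (L01 h') := by
    intro h hh h' hh' hlt
    obtain ⟨-, -, hlb⟩ := hmin h hh
    obtain ⟨θ, hθ, -⟩ := hmin h' hh'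
    linarith [hlb θ, mul_lt_mul_of_pos_right hlt (hgap θ)]
  ext h
  refine and_congr_right fun hh => forall₂_congr fun h' hh' => ⟨fun hle => ?_, hmono h hh h' hh'⟩
  exact not_lt.1 fun hlt => (hstrict h' hh' h hh hlt).not_ge hle
end

section
/- Fix 0 < τ < 1 and define g_τ(p) := 2[(1 − τ)(1 − p)(τp/D(p))² + τp((1 − τ)(1 − p)/D(p))²] for p ∈ [0, 1], where D(p) := (1 − τ)(1 − p) + τp. Then g_τ is strictly concave on the unit interval [0, 1]. -/
/-- The sum of the two Bernoulli loss terms is half of a harmonic mean. -/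
lemma mul_div_add_sq_add_mul_div_add_sq {a b : ℝ} (h : a + b ≠ 0) :
    a * (b / (a + b)) ^ 2 + b * (a / (a + b)) ^ 2 = a * b / (a + b) := by
  field_simp
  ring

/-- Superadditivity defect of the parallel sum `a * b / (a + b)`. -/
lemma parallel_sum_add_sub {a b c d : ℝ} (h₁ : a + b ≠ 0) (h₂ : c + d ≠ 0)
    (h : a + c + (b + d) ≠ 0) :
    (a + c) * (b + d) / (a + c + (b + d)) - a * b / (a + b) - c * d / (c + d)
      = (a * d - b * c) ^ 2 / ((a + b) * (c + d) * (a + c + (b + d))) := by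
  field_simp
  ring

lemma bernoulli_denominator_pos {τ p : ℝ} (hτ₀ : 0 < τ) (hτ₁ : τ < 1)
    (hp : p ∈ Set.Icc (0 : ℝ) 1) : 0 < (1 - τ) * (1 - p) + τ * p := by
  obtain ⟨h₀, h₁⟩ := hp
  rcases h₀.eq_or_lt with rfl | h₀
  · linarith
  · have := mul_pos hτ₀ h₀
    have := mul_nonneg (sub_nonneg.2 hτ₁.le) (sub_nonneg.2 h₁)
    linarith

/-- Strict concavity on `[0, 1]` of the variantile of a Bernoulli(p) loss:
`g_τ(p) = 2[(1−τ)(1−p)(τp/D(p))² + τp((1−τ)(1−p)/D(p))²]` with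
`D(p) = (1−τ)(1−p) + τp`. -/
theorem variantile_strict_concave (τ : ℝ) (hτ₀ : 0 < τ) (hτ₁ : τ < 1) :
    StrictConcaveOn ℝ (Set.Icc (0 : ℝ) 1)
      (fun p : ℝ =>
        2 * ((1 - τ) * (1 - p) * (τ * p / ((1 - τ) * (1 - p) + τ * p)) ^ 2
          + τ * p * ((1 - τ) * (1 - p) / ((1 - τ) * (1 - p) + τ * p)) ^ 2)) := by
  refine ⟨convex_Icc 0 1, fun x hx y hy hxy s t hs ht hst => ?_⟩
  have hDx := bernoulli_denominator_pos hτ₀ hτ₁ hx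
  have hDy := bernoulli_denominator_pos hτ₀ hτ₁ hy
  have hDz := bernoulli_denominator_pos hτ₀ hτ₁ (convex_Icc (0 : ℝ) 1 hx hy hs.le ht.le hst)
  simp only [smul_eq_mul] at hDz ⊢
  rw [mul_div_add_sq_add_mul_div_add_sq hDx.ne', mul_div_add_sq_add_mul_div_add_sq hDy.ne',
    mul_div_add_sq_add_mul_div_add_sq hDz.ne']
  have hz : (1 - τ) * (1 - (s * x + t * y))
      = s * ((1 - τ) * (1 - x)) + t * ((1 - τ) * (1 - y)) := by
    linear_combination (τ - 1) * hst
  have hz' : τ * (s * x + t * y) = s * (τ * x) + t * (τ * y) := by ring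
  have hcross : (1 - τ) * (1 - x) * (τ * y) - τ * x * ((1 - τ) * (1 - y)) ≠ 0 := by
    have h : (1 - τ) * (1 - x) * (τ * y) - τ * x * ((1 - τ) * (1 - y))
        = (1 - τ) * τ * (y - x) := by ring
    rw [h]
    exact mul_ne_zero (mul_pos (sub_pos.2 hτ₁) hτ₀).ne' (sub_ne_zero.2 hxy.symm)
  rw [hz, hz'] at hDz ⊢
  generalize (1 - τ) * (1 - x) = a at *
  generalize (1 - τ) * (1 - y) = c at *
  generalize τ * x = b at *
  generalize τ * y = d at *
  have hsab : 0 < s * a + s * b := by rw [← mul_add]; exact mul_pos hs hDx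
  have htcd : 0 < t * c + t * d := by rw [← mul_add]; exact mul_pos ht hDy
  have scale : ∀ {r u v : ℝ}, 0 < r → 0 < u + v →
      r * u * (r * v) / (r * u + r * v) = r * (u * v / (u + v)) := by
    intro r u v hr huv
    rw [← mul_add]
    field_simp
  have key := parallel_sum_add_sub hsab.ne' htcd.ne' hDz.ne'
  rw [scale hs hDx, scale ht hDy] at key
  have hne : s * a * (t * d) - s * b * (t * c) ≠ 0 := by
    have h : s * a * (t * d) - s * b * (t * c) = s * t * (a * d - b * c) := by ring
    rw [h]
    exact mul_ne_zero (mul_pos hs ht).ne' hcross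
  have hpos := div_pos (pow_pos (abs_pos.2 hne) 2) (mul_pos (mul_pos hsab htcd) hDz)
  rw [sq_abs, ← key] at hpos
  linarith
end

section
/- Fix 0 < β < 1 and suppose the hypothesis class H satisfies max_{h ∈ H} err(h) ≤ 1 − β, i.e., err(h) ≤ 1 − β for every h ∈ H. Then the CVaR-optimal classifiers under the zero-one loss coincide exactly with the error-probability minimizers: argmin_{h ∈ H} CVaR_β(L01(h)) = Herr. -/
open MeasureTheory Set
open scoped Classical

theorem integral_max_indicator_sub {Ω : Type*} [MeasurableSpace Ω] (μ : Measure Ω)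
    [IsProbabilityMeasure μ] {A : Set Ω} (hA : MeasurableSet A) (θ : ℝ) :
    ∫ ω, max (A.indicator 1 ω - θ) 0 ∂μ
      = μ.real A * max (1 - θ) 0 + (1 - μ.real A) * max (-θ) 0 := by
  have h : (fun ω => max (A.indicator (1 : Ω → ℝ) ω - θ) 0)
      = fun ω => A.indicator (fun _ => max (1 - θ) 0 - max (-θ) 0) ω + max (-θ) 0 := by
    ext ω
    by_cases hω : ω ∈ A <;> simp [hω]
  rw [h, integral_add ((integrable_const _).indicator hA) (integrable_const _),
    integral_indicator_const _ hA, integral_const]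
  simp only [probReal_univ, smul_eq_mul]
  ring

/-- At level `1 - c`, the conditional value at risk of the indicator of an event of probability
at most `c` is that probability divided by `c`. -/
theorem iInf_add_integral_max_indicator_sub_div {Ω : Type*} [MeasurableSpace Ω] (μ : Measure Ω)
    [IsProbabilityMeasure μ] {A : Set Ω} (hA : MeasurableSet A) {c : ℝ} (hc₀ : 0 < c)
    (hc₁ : c ≤ 1) (hAc : μ.real A ≤ c) :
    ⨅ θ : ℝ, θ + (∫ ω, max (A.indicator 1 ω - θ) 0 ∂μ) / c = μ.real A / c := by
  simp only [integral_max_indicator_sub μ hA]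
  have hlb (θ : ℝ) : μ.real A / c
      ≤ θ + (μ.real A * max (1 - θ) 0 + (1 - μ.real A) * max (-θ) 0) / c := by
    have hp₀ : 0 ≤ μ.real A := measureReal_nonneg
    have hp₁ : μ.real A ≤ 1 := hAc.trans hc₁
    rw [← sub_le_iff_le_add', div_sub' hc₀.ne', div_le_div_iff_of_pos_right hc₀]
    have h₁ := mul_le_mul_of_nonneg_left (le_max_left (1 - θ) 0) hp₀
    rcases le_total 0 θ with hθ | hθ
    · have h₂ := mul_nonneg (sub_nonneg.2 hp₁) (le_max_right (-θ) 0)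
      nlinarith
    · have h₂ := mul_le_mul_of_nonneg_left (le_max_left (-θ) 0) (sub_nonneg.2 hp₁)
      nlinarith
  refine le_antisymm ?_ (le_ciInf hlb)
  refine (ciInf_le ⟨_, forall_mem_range.2 hlb⟩ 0).trans_eq ?_
  simp

/-- When the model is good relative to `β`: if `err h ≤ 1 − β` for every
`h ∈ H`, then the CVaR-optimal classifiers under the zero-one loss coincide
exactly with the error-probability minimizers. -/
theorem cvar_coincide_when_model_good
    {Ω 𝒳 𝒴 : Type*} [MeasurableSpace Ω]
    (μ : Measure Ω) [IsProbabilityMeasure μ]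
    (X : Ω → 𝒳) (Y : Ω → 𝒴)
    (H : Set (𝒳 → 𝒴))
    (hmeasH : ∀ g ∈ H, MeasurableSet {ω | g (X ω) ≠ Y ω})
    (β : ℝ) (hβ₀ : 0 < β) (hβ₁ : β < 1)
    (L01 : (𝒳 → 𝒴) → Ω → ℝ)
    (hL01 : ∀ g : 𝒳 → 𝒴, ∀ ω : Ω, L01 g ω = if g (X ω) ≠ Y ω then 1 else 0)
    (err : (𝒳 → 𝒴) → ℝ)
    (herr : ∀ g : 𝒳 → 𝒴, err g = (μ {ω | g (X ω) ≠ Y ω}).toReal)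
    (CVaR : (Ω → ℝ) → ℝ)
    (hCVaR : ∀ L : Ω → ℝ,
      CVaR L = ⨅ θ : ℝ, θ + (∫ ω, max (L ω - θ) 0 ∂μ) / (1 - β))
    (hgood : ∀ g ∈ H, err g ≤ 1 - β) :
    {h ∈ H | ∀ h' ∈ H, CVaR (L01 h) ≤ CVaR (L01 h')}
      = {h ∈ H | ∀ h' ∈ H, err h ≤ err h'} := by
  have hc : 0 < 1 - β := sub_pos.2 hβ₁
  have key : ∀ g ∈ H, CVaR (L01 g) = err g / (1 - β) := by
    intro g hg
    have hL : L01 g = {ω | g (X ω) ≠ Y ω}.indicator 1 := by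
      ext ω
      simp [hL01, indicator_apply]
    have hp := hgood g hg
    rw [herr] at hp
    rw [hCVaR, hL, herr]
    exact iInf_add_integral_max_indicator_sub_div μ (hmeasH g hg) hc (by linarith) hp
  ext h
  refine and_congr_right fun hh => forall₂_congr fun h' hh' => ?_
  rw [key h hh, key h' hh', div_le_div_iff_of_pos_right hc]
end

section
/- Under the binary-classification surrogate setting, if a score s* ∈ S minimizes s ↦ OCE(φ(Y s(X))) over S, then the induced classifier h_{s*} := sign(s*(·)) minimizes the error probability: argmin_{h ∈ H} OCE(L_φ(h)) ⊂ Herr. -/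
open MeasureTheory Set
open scoped Classical

/-- If `u` and `d` have opposite signs, then `u + d` and `0` lie between them. -/
lemma ConvexOn.add_map_zero_le {ψ : ℝ → ℝ} (hψ : ConvexOn ℝ univ ψ) {u d : ℝ}
    (h : u * d ≤ 0) : ψ (u + d) + ψ 0 ≤ ψ u + ψ d := by
  rcases eq_or_ne u d with rfl | hne
  · obtain rfl : u = 0 := by nlinarith
    simp
  have hne' : u - d ≠ 0 := sub_ne_zero.mpr hne
  have hsq : 0 < (u - d) ^ 2 := by positivity
  have ha : 0 ≤ u / (u - d) := by
    rw [show u / (u - d) = (u * (u - d)) / (u - d) ^ 2 by field_simp]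
    exact div_nonneg (by nlinarith) hsq.le
  have hb : 0 ≤ -d / (u - d) := by
    rw [show -d / (u - d) = (-d * (u - d)) / (u - d) ^ 2 by field_simp]
    exact div_nonneg (by nlinarith) hsq.le
  have hab : u / (u - d) + -d / (u - d) = 1 := by field_simp; ring
  have h1 := hψ.2 (mem_univ u) (mem_univ d) ha hb hab
  have h2 := hψ.2 (mem_univ u) (mem_univ d) hb ha (by rw [add_comm, hab])
  simp only [smul_eq_mul] at h1 h2
  rw [show u / (u - d) * u + -d / (u - d) * d = u + d by field_simp; ring] at h1
  rw [show -d / (u - d) * u + u / (u - d) * d = 0 by field_simp; ring] at h2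
  have h3 : (u / (u - d) + -d / (u - d)) * (ψ u + ψ d) = ψ u + ψ d := by rw [hab, one_mul]
  nlinarith

lemma HasDerivAt.nonneg_of_forall_le {f : ℝ → ℝ} {f' : ℝ} (hf : HasDerivAt f f' 0)
    (h : ∀ t, 0 ≤ t → f 0 ≤ f t) : 0 ≤ f' := by
  refine ge_of_tendsto hf.tendsto_slope_zero_right ?_
  filter_upwards [self_mem_nhdsWithin] with t ht
  have ht : 0 < t := ht
  simpa using mul_nonneg (inv_nonneg.mpr ht.le) (sub_nonneg.mpr (h t ht.le))

/-- A differentiable convex strictly increasing function has positive derivative. -/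
lemma ConvexOn.deriv_pos_of_strictMono {ρ : ℝ → ℝ} (hρ : ConvexOn ℝ univ ρ)
    (hd : Differentiable ℝ ρ) (hm : StrictMono ρ) (x : ℝ) : 0 < deriv ρ x := by
  have h := hρ.slope_le_of_hasDerivAt (mem_univ (x - 1)) (mem_univ x) (by linarith)
    (hd x).hasDerivAt
  rw [slope_def_field] at h
  have h' := hm (show x - 1 < x by linarith)
  have : x - (x - 1) = 1 := by ring
  rw [this, div_one] at h
  linarith

lemma integrable_indicator_mul_label {Ω 𝒳 : Type*} [MeasurableSpace Ω] [MeasurableSpace 𝒳]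
    {μ : Measure Ω} [IsFiniteMeasure μ] {X : Ω → 𝒳} (hX : Measurable X)
    {Y : Ω → ℝ} (hY : Measurable Y) (hYval : ∀ ω, Y ω = 1 ∨ Y ω = -1)
    {A : Set 𝒳} (hA : MeasurableSet A) :
    Integrable (fun ω => A.indicator (1 : 𝒳 → ℝ) (X ω) * Y ω) μ := by
  refine Integrable.of_bound
    (((measurable_one.indicator hA).comp hX).mul hY).aestronglyMeasurable 1
    (.of_forall fun ω => ?_)
  by_cases hx : X ω ∈ A <;> rcases hYval ω with hy | hy <;> simp [hx, hy]

/-- A minimizer of a convex margin risk over all measurable scores has the sign of the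
conditional mean of the label. -/
lemma sign_mul_integral_label_nonneg {Ω 𝒳 : Type*} [MeasurableSpace Ω] [MeasurableSpace 𝒳]
    {μ : Measure Ω} [IsProbabilityMeasure μ] {X : Ω → 𝒳} (hX : Measurable X)
    {Y : Ω → ℝ} (hY : Measurable Y) (hYval : ∀ ω, Y ω = 1 ∨ Y ω = -1)
    {ψ : ℝ → ℝ} (hψ : ConvexOn ℝ univ ψ) {ψ' : ℝ} (hψd : HasDerivAt ψ ψ' 0) (hψ' : ψ' < 0)
    (hInt : ∀ s : 𝒳 → ℝ, Measurable s → Integrable (fun ω => ψ (Y ω * s (X ω))) μ)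
    {s : 𝒳 → ℝ} (hs : Measurable s)
    (hmin : ∀ r : 𝒳 → ℝ, Measurable r →
      ∫ ω, ψ (Y ω * s (X ω)) ∂μ ≤ ∫ ω, ψ (Y ω * r (X ω)) ∂μ)
    {A : Set 𝒳} (hA : MeasurableSet A) {σ : ℝ} (hσ : ∀ x ∈ A, 0 ≤ σ * s x) :
    0 ≤ σ * ∫ ω, A.indicator 1 (X ω) * Y ω ∂μ := by
  set m : ℝ := ∫ ω, A.indicator 1 (X ω) ∂μ
  set J : ℝ := ∫ ω, A.indicator 1 (X ω) * Y ω ∂μ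
  have hAm : Measurable fun ω => A.indicator (1 : 𝒳 → ℝ) (X ω) :=
    (measurable_one.indicator hA).comp hX
  have hi1 : Integrable (fun ω => A.indicator (1 : 𝒳 → ℝ) (X ω)) μ := by
    refine Integrable.of_bound hAm.aestronglyMeasurable 1 (.of_forall fun ω => ?_)
    by_cases h : X ω ∈ A <;> simp [h]
  have hi2 : Integrable (fun ω => A.indicator (1 : 𝒳 → ℝ) (X ω) * Y ω) μ :=
    integrable_indicator_mul_label hX hY hYval hA
  let f : ℝ → ℝ := fun t =>
    m * ((ψ (-σ * t) + ψ (σ * t)) / 2) + J * ((ψ (-σ * t) - ψ (σ * t)) / 2)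
  have hf : HasDerivAt f (σ * J * -ψ') 0 := by
    have h1 (c : ℝ) : HasDerivAt (fun t => ψ (c * t)) (ψ' * c) 0 := by
      have hc : HasDerivAt (fun t : ℝ => c * t) c 0 := by
        simpa using (hasDerivAt_id (0 : ℝ)).const_mul c
      exact HasDerivAt.comp (0 : ℝ) (by simpa using hψd) hc
    refine HasDerivAt.congr_deriv (((((h1 (-σ)).add (h1 σ)).div_const 2).const_mul m).add
      ((((h1 (-σ)).sub (h1 σ)).div_const 2).const_mul J)) ?_
    ring
  have hf0 : ∀ t, 0 ≤ t → f 0 ≤ f t := by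
    intro t ht
    have hr : Measurable fun x => s x + A.indicator 1 x * (-σ * t) :=
      hs.add ((measurable_one.indicator hA).mul_const _)
    have hle := (hmin _ hr).trans (integral_mono (hInt _ hr)
      (g := fun ω => ψ (Y ω * s (X ω)) +
        (A.indicator 1 (X ω) * ((ψ (-σ * t) + ψ (σ * t)) / 2 - ψ 0) +
          A.indicator 1 (X ω) * Y ω * ((ψ (-σ * t) - ψ (σ * t)) / 2)))
      ((hInt s hs).add ((hi1.mul_const _).add (hi2.mul_const _))) fun ω => ?_)
    · rw [integral_add (hInt s hs) ((hi1.mul_const _).fun_add (hi2.mul_const _)),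
        integral_add (hi1.mul_const _) (hi2.mul_const _), integral_mul_const,
        integral_mul_const] at hle
      simp only [f, mul_zero]
      change _ ≤ _ + (m * _ + J * _) at hle
      linarith
    · by_cases h : X ω ∈ A
      · have h0 := mul_nonneg (hσ _ h) ht
        rcases hYval ω with h' | h'
        · have := hψ.add_map_zero_le (u := s (X ω)) (d := -σ * t) (by linarith)
          simp only [h, h', indicator_of_mem, Pi.one_apply, one_mul]
          linarith
        · have := hψ.add_map_zero_le (u := -s (X ω)) (d := σ * t) (by linarith)
          simp only [h, h', indicator_of_mem, Pi.one_apply, one_mul]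
          rw [show -1 * (s (X ω) + -σ * t) = -s (X ω) + σ * t by ring, neg_one_mul (s (X ω))]
          linarith
      · simp [h]
  exact nonneg_of_mul_nonneg_left (hf.nonneg_of_forall_le hf0) (by linarith)

/-- Unavoidable collapse under OCE criteria with strictly increasing `ρ` and a
classification-calibrated margin penalizer `φ`: over the class of all
measurable scores, any score minimizing the OCE surrogate criterion induces a
classifier that minimizes the error probability. -/
theorem oce_surrogate_minimizers_in_Herr
    {Ω 𝒳 : Type*} [MeasurableSpace Ω] [MeasurableSpace 𝒳]
    (μ : Measure Ω) [IsProbabilityMeasure μ]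
    (X : Ω → 𝒳) (hX : Measurable X)
    (Y : Ω → ℝ) (hY : Measurable Y) (hYval : ∀ ω : Ω, Y ω = 1 ∨ Y ω = -1)
    (φ : ℝ → ℝ) (hφ_nonneg : ∀ u : ℝ, 0 ≤ φ u) (hφ_conv : ConvexOn ℝ Set.univ φ)
    (φ'0 : ℝ) (hφ_deriv : HasDerivAt φ φ'0 0) (hφ'0 : φ'0 < 0)
    (ρ : ℝ → ℝ) (hρ_conv : ConvexOn ℝ Set.univ ρ) (hρ_diff : Differentiable ℝ ρ)
    (hρ_mono : StrictMono ρ) (hρ₀ : ρ 0 = 0) (hρ'₀ : deriv ρ 0 = 1)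
    (hInt : ∀ s : 𝒳 → ℝ, Measurable s → ∀ θ : ℝ,
      Integrable (fun ω => ρ (φ (Y ω * s (X ω)) - θ)) μ)
    (OCE : (𝒳 → ℝ) → ℝ)
    (hOCE : ∀ s : 𝒳 → ℝ,
      OCE s = ⨅ θ : ℝ, θ + ∫ ω, ρ (φ (Y ω * s (X ω)) - θ) ∂μ)
    (hattain : ∀ s : 𝒳 → ℝ, Measurable s → ∃ θ₀ : ℝ,
      θ₀ + ∫ ω, ρ (φ (Y ω * s (X ω)) - θ₀) ∂μ = OCE s)
    (Err : (𝒳 → ℝ) → ℝ)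
    (hErr : ∀ s : 𝒳 → ℝ,
      Err s = (μ {ω | (if 0 ≤ s (X ω) then (1 : ℝ) else -1) ≠ Y ω}).toReal) :
    ∀ sStar : 𝒳 → ℝ, Measurable sStar →
      (∀ s : 𝒳 → ℝ, Measurable s → OCE sStar ≤ OCE s) →
      ∀ s : 𝒳 → ℝ, Measurable s → Err sStar ≤ Err s := by
  intro sStar hsStar hopt s hs
  obtain ⟨θ, hθ⟩ := hattain sStar hsStar
  have hρ_ge : ∀ t, t ≤ ρ t := by
    intro t
    have hd : HasDerivAt ρ 1 0 := hρ'₀ ▸ (hρ_diff 0).hasDerivAt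
    rcases lt_trichotomy t 0 with ht | rfl | ht
    · have h := hρ_conv.slope_le_of_hasDerivAt (mem_univ t) (mem_univ 0) ht hd
      rw [slope_def_field, div_le_one (by linarith)] at h
      linarith
    · exact hρ₀.ge
    · have h := hρ_conv.le_slope_of_hasDerivAt (mem_univ 0) (mem_univ t) ht hd
      rw [slope_def_field, le_div_iff₀ (by linarith)] at h
      linarith
  have hbdd : ∀ r : 𝒳 → ℝ, Measurable r →
      BddBelow (range fun θ : ℝ => θ + ∫ ω, ρ (φ (Y ω * r (X ω)) - θ) ∂μ) := by
    refine fun r hr => ⟨0, ?_⟩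
    rintro _ ⟨θ, rfl⟩
    have h := integral_mono (integrable_const (-θ)) (hInt r hr θ) fun ω =>
      (by linarith [hφ_nonneg (Y ω * r (X ω))] : -θ ≤ φ (Y ω * r (X ω)) - θ).trans (hρ_ge _)
    simp only [integral_const, probReal_univ, one_smul] at h
    linarith
  have hmin : ∀ r : 𝒳 → ℝ, Measurable r →
      ∫ ω, ρ (φ (Y ω * sStar (X ω)) - θ) ∂μ ≤ ∫ ω, ρ (φ (Y ω * r (X ω)) - θ) ∂μ := by
    intro r hr
    have h1 := hopt r hr
    rw [← hθ, hOCE r] at h1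
    linarith [ciInf_le (hbdd r hr) θ]
  have hψ : ConvexOn ℝ univ fun u => ρ (φ u - θ) := by
    refine ⟨convex_univ, fun x _ y _ a b ha hb hab => ?_⟩
    refine le_trans (hρ_mono.monotone ?_)
      (hρ_conv.2 (mem_univ (φ x - θ)) (mem_univ (φ y - θ)) ha hb hab)
    have h := hφ_conv.2 (mem_univ x) (mem_univ y) ha hb hab
    simp only [smul_eq_mul] at h ⊢
    have : a * θ + b * θ = θ := by rw [← add_mul, hab, one_mul]
    linarith
  have hψd : HasDerivAt (fun u => ρ (φ u - θ)) (deriv ρ (φ 0 - θ) * φ'0) 0 :=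
    HasDerivAt.comp (0 : ℝ) (hρ_diff _).hasDerivAt (hφ_deriv.sub_const θ)
  have hψ' : deriv ρ (φ 0 - θ) * φ'0 < 0 :=
    mul_neg_of_pos_of_neg (hρ_conv.deriv_pos_of_strictMono hρ_diff hρ_mono _) hφ'0
  have hP : MeasurableSet {x | 0 ≤ sStar x} := measurableSet_le measurable_const hsStar
  have hQ : MeasurableSet {x | 0 ≤ s x} := measurableSet_le measurable_const hs
  have hB := sign_mul_integral_label_nonneg hX hY hYval hψ hψd hψ'
    (fun r hr => hInt r hr θ) hsStar hmin (hP.diff hQ) (σ := 1)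
    (fun x hx => by simpa using hx.1)
  have hC := sign_mul_integral_label_nonneg hX hY hYval hψ hψd hψ'
    (fun r hr => hInt r hr θ) hsStar hmin (hQ.diff hP) (σ := -1)
    (fun x hx => by simpa using (not_le.mp hx.2).le)
  have hmeas (r : 𝒳 → ℝ) (hr : Measurable r) :
      MeasurableSet {ω | (if 0 ≤ r (X ω) then (1 : ℝ) else -1) ≠ Y ω} :=
    (measurableSet_eq_fun (Measurable.ite (measurableSet_le measurable_const (hr.comp hX))
      measurable_const measurable_const) hY).compl
  have hlab {A : Set 𝒳} (hA : MeasurableSet A) :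
      Integrable (fun ω => A.indicator (1 : 𝒳 → ℝ) (X ω) * Y ω) μ :=
    integrable_indicator_mul_label hX hY hYval hA
  have herr (r : 𝒳 → ℝ) (hr : Measurable r) : Err r =
      ∫ ω, {ω | (if 0 ≤ r (X ω) then (1 : ℝ) else -1) ≠ Y ω}.indicator 1 ω ∂μ := by
    rw [hErr, integral_indicator_one (hmeas r hr), measureReal_def]
  have hind (r : 𝒳 → ℝ) (hr : Measurable r) : Integrable
      ({ω | (if 0 ≤ r (X ω) then (1 : ℝ) else -1) ≠ Y ω}.indicator (1 : Ω → ℝ)) μ :=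
    (integrable_const (1 : ℝ)).indicator (hmeas r hr)
  have hdiff : Err s = Err sStar +
      (∫ ω, ({x | 0 ≤ sStar x} \ {x | 0 ≤ s x}).indicator 1 (X ω) * Y ω ∂μ -
        ∫ ω, ({x | 0 ≤ s x} \ {x | 0 ≤ sStar x}).indicator 1 (X ω) * Y ω ∂μ) := by
    rw [herr s hs, herr sStar hsStar, ← integral_sub (hlab (hP.diff hQ)) (hlab (hQ.diff hP)),
      ← integral_add (hind sStar hsStar) ((hlab (hP.diff hQ)).sub' (hlab (hQ.diff hP)))]
    refine integral_congr_ae (.of_forall fun ω => ?_)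
    by_cases h1 : 0 ≤ sStar (X ω) <;> by_cases h2 : 0 ≤ s (X ω) <;>
      rcases hYval ω with h' | h' <;> norm_num [indicator, h1, h2, h']
  linarith
end

section
/- Under the binary-classification surrogate setting, if a sequence of scores (s_1, s_2, …) ⊂ S satisfies OCE(φ(Y s_n(X))) → inf_{s ∈ S} OCE(φ(Y s(X))) as n → ∞, then the error probabilities of the induced classifiers h_n := sign(s_n(·)) converge to the optimal error probability: err(h_n) → err* := inf_{h ∈ H} err(h). -/
open MeasureTheory Set Filter
open scoped Classical Topology

lemma ConvexOn.add_mul_sub_le_of_hasDerivAt {f : ℝ → ℝ} (hf : ConvexOn ℝ Set.univ f)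
    {f' x : ℝ} (hd : HasDerivAt f f' x) (y : ℝ) : f x + f' * (y - x) ≤ f y := by
  rcases lt_trichotomy x y with h | rfl | h
  · have := hf.le_slope_of_hasDerivAt (mem_univ x) (mem_univ y) h hd
    rw [slope_def_field, le_div_iff₀ (sub_pos.2 h)] at this
    linarith
  · simp
  · have := hf.slope_le_of_hasDerivAt (mem_univ y) (mem_univ x) h hd
    rw [slope_def_field, div_le_iff₀ (sub_pos.2 h)] at this
    linarith

lemma ConvexOn.two_mul_apply_zero_le {f : ℝ → ℝ} (hf : ConvexOn ℝ Set.univ f) (v : ℝ) :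
    2 * f 0 ≤ f v + f (-v) := by
  have h := hf.2 (mem_univ v) (mem_univ (-v))
    (show (0 : ℝ) ≤ 1 / 2 by norm_num) (show (0 : ℝ) ≤ 1 / 2 by norm_num) (by norm_num)
  simp only [smul_eq_mul] at h
  rw [show 1 / 2 * v + 1 / 2 * -v = 0 by ring] at h
  linarith

lemma ConvexOn.comp_sub_const {φ ρ : ℝ → ℝ} (hφ : ConvexOn ℝ Set.univ φ)
    (hρ : ConvexOn ℝ Set.univ ρ) (hmono : Monotone ρ) (θ : ℝ) :
    ConvexOn ℝ Set.univ (fun u => ρ (φ u - θ)) := by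
  refine ⟨convex_univ, fun x _ y _ a b ha hb hab => ?_⟩
  have h1 := hφ.2 (mem_univ x) (mem_univ y) ha hb hab
  have h2 := hρ.2 (mem_univ (φ x - θ)) (mem_univ (φ y - θ)) ha hb hab
  refine (hmono ?_).trans h2
  simp only [smul_eq_mul] at h1 ⊢
  have : a * (φ x - θ) + b * (φ y - θ) = a * φ x + b * φ y - (a + b) * θ := by ring
  rw [this, hab]
  linarith

lemma continuous_deriv_of_monotone {f : ℝ → ℝ} (hf : Differentiable ℝ f)
    (hm : Monotone (deriv f)) : Continuous (deriv f) := by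
  have hoc : OrdConnected (range (deriv f)) := by
    rw [← image_univ]
    exact ordConnected_univ.image_deriv fun x _ => hf x
  refine continuous_iff_continuousAt.2 fun x => tendsto_order.2 ⟨fun b hb => ?_, fun b hb => ?_⟩
  · by_cases h : ∃ y < x, b < deriv f y
    · obtain ⟨y, hyx, hy⟩ := h
      filter_upwards [lt_mem_nhds hyx] with z hz using hy.trans_le (hm hz.le)
    · push Not at h
      obtain ⟨m, hbm, hmx⟩ := exists_between hb
      obtain ⟨z, hz⟩ := hoc.out (mem_range_self (x - 1)) (mem_range_self x)
        ⟨(h (x - 1) (by linarith)).trans hbm.le, hmx.le⟩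
      rcases lt_or_ge z x with hzx | hzx
      · exact absurd (h z hzx) (by linarith)
      · exact absurd (hm hzx) (by linarith)
  · by_cases h : ∃ y > x, deriv f y < b
    · obtain ⟨y, hyx, hy⟩ := h
      filter_upwards [gt_mem_nhds hyx] with z hz using (hm hz.le).trans_lt hy
    · push Not at h
      obtain ⟨m, hxm, hmb⟩ := exists_between hb
      obtain ⟨z, hz⟩ := hoc.out (mem_range_self x) (mem_range_self (x + 1))
        ⟨hxm.le, hmb.le.trans (h (x + 1) (by linarith))⟩
      rcases lt_or_ge x z with hzx | hzx
      · exact absurd (h z hzx) (by linarith)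
      · exact absurd (hm hzx) (by linarith)

lemma HasDerivAt.exists_symmetric_increment_le {φ : ℝ → ℝ} {φ' : ℝ} (hφ : HasDerivAt φ φ' 0)
    (hφ' : φ' < 0) {η r : ℝ} (hη : 0 < η) (hr : 0 < r) :
    ∃ δ > 0, 0 < φ 0 - φ δ ∧ φ (-δ) - φ 0 ≤ (1 + η) * (φ 0 - φ δ) ∧ φ (-δ) - φ 0 ≤ r := by
  set c : ℝ := η * (-φ') / (2 + η) with hc
  have hcpos : 0 < c := by
    have : 0 < -φ' := by linarith
    positivity
  have hceq : c * (2 + η) = η * (-φ') := by rw [hc]; field_simp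
  have hlin : ∀ᶠ t in 𝓝 (0 : ℝ), |φ t - φ 0 - t * φ'| ≤ c * |t| := by
    have := (hasDerivAt_iff_isLittleO.1 hφ).def hcpos
    simpa using this
  have hnear : ∀ᶠ t in 𝓝 (0 : ℝ), φ t < φ 0 + r :=
    hφ.continuousAt.eventually_lt continuousAt_const (by linarith)
  have hneg : Tendsto (fun t : ℝ => -t) (𝓝 0) (𝓝 0) := by
    simpa using (continuous_neg (G := ℝ)).tendsto 0
  have hev := (hlin.and ((hneg.eventually hlin).and (hneg.eventually hnear)))
  obtain ⟨δ, ⟨h1, h2, h3⟩, hδ⟩ :=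
    ((hev.filter_mono nhdsWithin_le_nhds).and (self_mem_nhdsWithin (s := Ioi (0 : ℝ)))).exists
  have hδ : 0 < δ := hδ
  rw [abs_of_pos hδ] at h1
  rw [abs_neg, abs_of_pos hδ] at h2
  have h1 := (abs_le.1 h1).2
  have h2 := (abs_le.1 h2).2
  have hcd : 0 < -φ' - c := by nlinarith
  refine ⟨δ, hδ, ?_, ?_, by linarith⟩
  · nlinarith [mul_pos hcd hδ]
  · have e1 : (-φ' - c) * δ ≤ φ 0 - φ δ := by linarith
    have e2 : φ (-δ) - φ 0 ≤ (-φ' + c) * δ := by linarith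
    have e3 : (-φ' + c) = (1 + η) * (-φ' - c) := by linarith
    calc φ (-δ) - φ 0 ≤ (1 + η) * ((-φ' - c) * δ) := by rw [← mul_assoc, ← e3]; exact e2
      _ ≤ _ := by gcongr

/-- The risk parameters `θ` of bounded cost `θ + ρ (-θ)` form a bounded set, unless `ρ` is the
identity on the negative half-line. -/
lemma exists_bound_or_eq_self {ρ : ℝ → ℝ} (hρ : ConvexOn ℝ Set.univ ρ) (hρ₀ : ρ 0 = 0)
    (hle : ∀ x, x ≤ ρ x) (M : ℝ) :
    (∃ T, ∀ θ, 0 ≤ θ → θ + ρ (-θ) ≤ M → θ ≤ T) ∨ ∀ x ≤ 0, ρ x = x := by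
  by_cases h : ∀ x ≤ 0, ρ x = x
  · exact Or.inr h
  · push Not at h
    obtain ⟨x, hx, hne⟩ := h
    have hlt : x < ρ x := lt_of_le_of_ne (hle x) hne.symm
    have hx0 : x < 0 := lt_of_le_of_ne hx (by rintro rfl; exact hne hρ₀)
    refine Or.inl ⟨max (-x) (M * (-x) / (ρ x - x)), fun θ hθ hM => ?_⟩
    rcases le_or_gt θ (-x) with h | h
    · exact h.trans (le_max_left _ _)
    · refine le_trans ?_ (le_max_right _ _)
      rw [le_div_iff₀ (by linarith)]
      have hθ0 : 0 < θ := by linarith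
      have hconv := hρ.2 (mem_univ (-θ)) (mem_univ 0)
        (show 0 ≤ -x / θ from div_nonneg (by linarith) hθ)
        (show 0 ≤ 1 - -x / θ by rw [sub_nonneg, div_le_one hθ0]; exact h.le) (by ring)
      simp only [smul_eq_mul, hρ₀, mul_zero, add_zero] at hconv
      rw [show -x / θ * -θ = x by field_simp] at hconv
      have h2 : ρ x * θ ≤ -x * ρ (-θ) := by
        have := mul_le_mul_of_nonneg_right hconv hθ
        rwa [show -x / θ * ρ (-θ) * θ = -x * ρ (-θ) by field_simp] at this
      nlinarith

lemma exists_uniform_margin_gap {φ ρ : ℝ → ℝ} {φ' : ℝ} (hφ_nonneg : 0 ≤ φ 0)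
    (hφ_conv : ConvexOn ℝ Set.univ φ)
    (hφ : HasDerivAt φ φ' 0) (hφ' : φ' < 0)
    (hρ : ConvexOn ℝ Set.univ ρ) (hρ_diff : Differentiable ℝ ρ) (hρ_mono : StrictMono ρ)
    (hρ₀ : ρ 0 = 0) (hle : ∀ x, x ≤ ρ x) (M : ℝ) {ε : ℝ} (hε : 0 < ε) (hε1 : ε ≤ 1) :
    ∃ δ > 0, ∃ κ > 0, ∀ θ, 0 ≤ θ → θ + ρ (-θ) ≤ M →
      2 * κ + (ρ (φ (-δ) - θ) - ρ (φ 0 - θ)) ≤ (1 + ε) * (ρ (φ 0 - θ) - ρ (φ δ - θ)) := by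
  have htan : ∀ x y, ρ x + deriv ρ x * (y - x) ≤ ρ y := fun x y =>
    hρ.add_mul_sub_le_of_hasDerivAt (hρ_diff x).hasDerivAt y
  have hmono : Monotone (deriv ρ) := fun x y hxy =>
    hρ.monotoneOn_deriv (fun x _ => hρ_diff x) (mem_univ x) (mem_univ y) hxy
  have hcont : Continuous (deriv ρ) := continuous_deriv_of_monotone hρ_diff hmono
  have hpos : ∀ x, 0 < deriv ρ x := fun x => by
    have h1 := htan x (x - 1)
    have h2 := hρ_mono (show x - 1 < x by linarith)
    linarith
  obtain ⟨T, hT0, hT⟩ : ∃ T ≥ 0, ∀ θ, 0 ≤ θ → θ + ρ (-θ) ≤ M →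
      θ ≤ T ∨ (φ 0 + 1 ≤ θ ∧ ∀ x ≤ 0, ρ x = x) := by
    rcases exists_bound_or_eq_self hρ hρ₀ hle M with ⟨T, hT⟩ | h
    · exact ⟨max T 0, le_max_right _ _, fun θ h0 hM => Or.inl ((hT θ h0 hM).trans (le_max_left _ _))⟩
    · exact ⟨φ 0 + 1, by linarith, fun θ _ _ => (le_total θ (φ 0 + 1)).imp_right fun h' => ⟨h', h⟩⟩
  set c := deriv ρ (φ 0 - T - 2) with hc
  have hcpos : 0 < c := hpos _
  obtain ⟨r, hr, hunif⟩ := Metric.uniformContinuousOn_iff.1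
    (isCompact_Icc.uniformContinuousOn_of_continuous
      (s := Icc (φ 0 - T - 2) (φ 0 + 2)) hcont.continuousOn) (ε / 4 * c) (by positivity)
  obtain ⟨δ, hδ, hq, hpq, hpr⟩ := hφ.exists_symmetric_increment_le hφ' (η := ε / 4)
    (r := min 1 (r / 4)) (by positivity) (by positivity)
  have hp1 : φ (-δ) - φ 0 ≤ 1 := hpr.trans (min_le_left _ _)
  have hpr : φ (-δ) - φ 0 ≤ r / 4 := hpr.trans (min_le_right _ _)
  have hqp : φ 0 - φ δ ≤ φ (-δ) - φ 0 := by linarith [hφ_conv.two_mul_apply_zero_le δ]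
  refine ⟨δ, hδ, ε / 8 * (φ 0 - φ δ) * min c 1, by positivity, fun θ hθ hM => ?_⟩
  have hmc : min c 1 ≤ c := min_le_left _ _
  have hm1 : min c 1 ≤ 1 := min_le_right _ _
  rcases hT θ hθ hM with hθT | ⟨hθ1, hid⟩
  · set q := φ 0 - φ δ with hq_def
    set p := φ (-δ) - φ 0 with hp_def
    set d := deriv ρ (φ δ - θ) with hd_def
    have hcd : c ≤ d := hmono (by linarith)
    have hclose : deriv ρ (φ (-δ) - θ) ≤ (1 + ε / 4) * d := by
      have := hunif (φ (-δ) - θ) ⟨by linarith, by linarith⟩ (φ δ - θ)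
        ⟨by linarith, by linarith⟩ (by rw [Real.dist_eq, abs_lt]; constructor <;> linarith)
      rw [Real.dist_eq] at this
      have h1 := (abs_lt.1 this).2
      nlinarith
    have hP : ρ (φ (-δ) - θ) - ρ (φ 0 - θ) ≤ (1 + ε / 4) * q * ((1 + ε / 4) * d) := by
      have h1 := htan (φ (-δ) - θ) (φ 0 - θ)
      have h2 : p * deriv ρ (φ (-δ) - θ) ≤ (1 + ε / 4) * q * ((1 + ε / 4) * d) :=
        mul_le_mul hpq hclose (hpos _).le (by positivity)
      rw [hp_def] at h2
      linarith
    have hQ : q * d ≤ ρ (φ 0 - θ) - ρ (φ δ - θ) := by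
      have h1 := htan (φ δ - θ) (φ 0 - θ)
      rw [hq_def]
      linarith
    have hqd : q * min c 1 ≤ q * d := mul_le_mul_of_nonneg_left (hmc.trans hcd) hq.le
    have hqd0 : 0 < q * d := mul_pos hq (hcpos.trans_le hcd)
    have hQ' := mul_le_mul_of_nonneg_left hQ (show 0 ≤ 1 + ε by linarith)
    have h3 := mul_le_mul_of_nonneg_left hqd hε.le
    have h4 : ε ^ 2 * (q * d) ≤ ε * (q * d) := by
      apply mul_le_mul_of_nonneg_right _ hqd0.le
      nlinarith
    have h5 := mul_pos hε hqd0
    nlinarith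
  · rw [hid _ (by linarith), hid _ (by linarith), hid _ (by linarith)]
    have h1 : ε * (φ 0 - φ δ) * min c 1 ≤ ε * (φ 0 - φ δ) * 1 := by gcongr
    have h2 := mul_pos hε hq
    nlinarith

section Bayes

variable {Ω 𝒳 : Type*} {mΩ : MeasurableSpace Ω} [m𝒳 : MeasurableSpace 𝒳] {μ : Measure Ω}
  {X : Ω → 𝒳} {Y : Ω → ℝ}

lemma integrable_of_sign [IsProbabilityMeasure μ] (hY : Measurable Y) (hYval : ∀ ω, Y ω = 1 ∨ Y ω = -1) :
    Integrable Y μ := by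
  refine Integrable.of_bound hY.aestronglyMeasurable 1 (ae_of_all _ fun ω => ?_)
  rcases hYval ω with h | h <;> simp [h]

/-- The sign `σ` of the regression function: `Y * σ(X)` has nonnegative conditional mean given
`X`. -/
lemma exists_bayes_sign [IsProbabilityMeasure μ] (hX : Measurable X) (hY : Measurable Y)
    (hYval : ∀ ω, Y ω = 1 ∨ Y ω = -1) :
    ∃ σ : 𝒳 → ℝ, Measurable σ ∧ (∀ x, σ x = 1 ∨ σ x = -1) ∧
      ∀ f : 𝒳 → ℝ, Measurable f → (∀ x, 0 ≤ f x) → Integrable (fun ω => f (X ω)) μ →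
        0 ≤ ∫ ω, Y ω * σ (X ω) * f (X ω) ∂μ := by
  have hYint : Integrable Y μ := integrable_of_sign hY hYval
  set m := MeasurableSpace.comap X m𝒳 with hm
  have hmle : m ≤ mΩ := hX.comap_le
  obtain ⟨η, hη, hηX⟩ := (stronglyMeasurable_condExp (μ := μ) (m := m)
    (f := Y)).exists_eq_measurable_comp
  have hσ : Measurable fun x => if 0 ≤ η x then (1 : ℝ) else -1 :=
    Measurable.ite (measurableSet_le measurable_const hη.measurable)
      measurable_const measurable_const
  have hval : ∀ x, (if 0 ≤ η x then (1 : ℝ) else -1) = 1 ∨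
      (if 0 ≤ η x then (1 : ℝ) else -1) = -1 := fun x => by
    split_ifs <;> simp
  refine ⟨_, hσ, hval, fun f hf hf0 hfint => ?_⟩
  set k : 𝒳 → ℝ := fun x => (if 0 ≤ η x then (1 : ℝ) else -1) * f x with hk
  have hkm : Measurable k := hσ.mul hf
  have hkint : Integrable (fun ω => Y ω * k (X ω)) μ := by
    refine hfint.mono (hY.mul (hkm.comp hX)).aestronglyMeasurable (ae_of_all _ fun ω => ?_)
    have habs : |k (X ω)| = |f (X ω)| := by
      simp only [hk]
      split_ifs <;> simp
    rcases hYval ω with h | h <;> simp [h, habs]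
  have hkX : StronglyMeasurable[m] fun ω => k (X ω) :=
    (hkm.comp (comap_measurable X)).stronglyMeasurable
  have hpull := condExp_mul_of_stronglyMeasurable_right (μ := μ) hkX hkint hYint
  have heq : ∫ ω, Y ω * k (X ω) ∂μ = ∫ ω, η (X ω) * k (X ω) ∂μ := by
    rw [← integral_condExp hmle (f := fun ω => Y ω * k (X ω))]
    refine integral_congr_ae (hpull.trans (ae_of_all _ fun ω => ?_))
    simp only [Pi.mul_apply, hηX, Function.comp_apply]
  simp only [mul_assoc]
  refine (integral_nonneg fun ω => ?_).trans_eq heq.symm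
  simp only [hk, Pi.zero_apply]
  split_ifs with h
  · have := hf0 (X ω); positivity
  · have := mul_nonneg (show 0 ≤ -η (X ω) by linarith) (hf0 (X ω))
    linarith

lemma measurable_ite_nonneg {s : 𝒳 → ℝ} (hs : Measurable s) :
    Measurable fun x => if 0 ≤ s x then (1 : ℝ) else -1 :=
  Measurable.ite (measurableSet_le measurable_const hs) measurable_const measurable_const

lemma measure_ne_toReal_eq_integral (hX : Measurable X) (hY : Measurable Y)
    (hYval : ∀ ω, Y ω = 1 ∨ Y ω = -1) {h : 𝒳 → ℝ} (hh : Measurable h)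
    (hval : ∀ x, h x = 1 ∨ h x = -1) :
    (μ {ω | h (X ω) ≠ Y ω}).toReal = ∫ ω, (1 - Y ω * h (X ω)) / 2 ∂μ := by
  have hset : MeasurableSet {ω | h (X ω) ≠ Y ω} :=
    (measurableSet_eq_fun (hh.comp hX) hY).compl
  change μ.real _ = _
  rw [← integral_indicator_one hset]
  refine integral_congr_ae (ae_of_all _ fun ω => ?_)
  by_cases hω : h (X ω) = Y ω
  · rcases hval (X ω) with h' | h' <;> rw [h'] at hω <;> simp [indicator, h', ← hω]
  · rcases hYval ω with h₁ | h₁ <;> rcases hval (X ω) with h₂ | h₂ <;>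
      simp_all [indicator]

lemma measure_ne_sub_measure_ne [IsProbabilityMeasure μ] (hX : Measurable X) (hY : Measurable Y)
    (hYval : ∀ ω, Y ω = 1 ∨ Y ω = -1) {h σ : 𝒳 → ℝ} (hh : Measurable h)
    (hval : ∀ x, h x = 1 ∨ h x = -1) (hσ : Measurable σ) (hσval : ∀ x, σ x = 1 ∨ σ x = -1) :
    (μ {ω | h (X ω) ≠ Y ω}).toReal - (μ {ω | σ (X ω) ≠ Y ω}).toReal =
      ∫ ω, Y ω * σ (X ω) * {x | h x ≠ σ x}.indicator 1 (X ω) ∂μ := by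
  have hint : ∀ k : 𝒳 → ℝ, Measurable k → (∀ x, k x = 1 ∨ k x = -1) →
      Integrable (fun ω => (1 - Y ω * k (X ω)) / 2) μ := fun k hk hkval => by
    refine Integrable.of_bound
      ((measurable_const.sub (hY.mul (hk.comp hX))).div_const 2).aestronglyMeasurable 1
      (ae_of_all _ fun ω => ?_)
    rcases hYval ω with h₁ | h₁ <;> rcases hkval (X ω) with h₂ | h₂ <;>
      simp [h₁, h₂]
  rw [measure_ne_toReal_eq_integral hX hY hYval hh hval,
    measure_ne_toReal_eq_integral hX hY hYval hσ hσval,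
    ← integral_sub (hint h hh hval) (hint σ hσ hσval)]
  refine integral_congr_ae (ae_of_all _ fun ω => ?_)
  rcases hval (X ω) with h₁ | h₁ <;> rcases hσval (X ω) with h₂ | h₂ <;>
    simp [indicator, h₁, h₂] <;> norm_num <;> ring

lemma integrable_comp_of_forall_sign (hX : Measurable X) (hYval : ∀ ω, Y ω = 1 ∨ Y ω = -1)
    {g : ℝ → ℝ} (hg : Measurable g)
    (hint : ∀ t : 𝒳 → ℝ, Measurable t → Integrable (fun ω => g (Y ω * t (X ω))) μ)
    {v : 𝒳 → ℝ} (hv : Measurable v) : Integrable (fun ω => g (v (X ω))) μ := by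
  refine ((hint v hv).norm.add (hint (fun x => -v x) hv.neg).norm).mono'
    (hg.comp (hv.comp hX)).aestronglyMeasurable (ae_of_all _ fun ω => ?_)
  rcases hYval ω with h | h <;> simp [h]

/-- Replacing a score by `δ * σ` where its sign disagrees with the Bayes sign `σ` decreases the
expected margin loss by an amount controlled by the excess classification error. -/
lemma exists_improved_score [IsProbabilityMeasure μ] (hX : Measurable X) (hY : Measurable Y)
    (hYval : ∀ ω, Y ω = 1 ∨ Y ω = -1) {σ : 𝒳 → ℝ} (hσ : Measurable σ)
    (hσval : ∀ x, σ x = 1 ∨ σ x = -1)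
    (hbayes : ∀ f : 𝒳 → ℝ, Measurable f → (∀ x, 0 ≤ f x) →
      Integrable (fun ω => f (X ω)) μ → 0 ≤ ∫ ω, Y ω * σ (X ω) * f (X ω) ∂μ)
    {s : 𝒳 → ℝ} (hs : Measurable s) (δ : ℝ) :
    ∃ t : 𝒳 → ℝ, Measurable t ∧ ∀ g : ℝ → ℝ, Measurable g → (∀ v ≤ 0, g 0 ≤ g v) →
      (∀ v, 2 * g 0 ≤ g v + g (-v)) →
      (∀ t : 𝒳 → ℝ, Measurable t → Integrable (fun ω => g (Y ω * t (X ω))) μ) →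
      ∫ ω, g (Y ω * t (X ω)) ∂μ + ((2 * g 0 - g δ - g (-δ)) / 2 +
        (∫ ω, Y ω * σ (X ω) * {x | (if 0 ≤ s x then (1 : ℝ) else -1) ≠ σ x}.indicator 1 (X ω) ∂μ)
          * ((g (-δ) - g δ) / 2)) ≤ ∫ ω, g (Y ω * s (X ω)) ∂μ := by
  set D : Set 𝒳 := {x | (if 0 ≤ s x then (1 : ℝ) else -1) ≠ σ x} with hD
  have hDm : MeasurableSet D := (measurableSet_eq_fun (measurable_ite_nonneg hs) hσ).compl
  have htm : Measurable fun x => if x ∈ D then δ * σ x else s x :=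
    Measurable.ite hDm (hσ.const_mul δ) hs
  refine ⟨_, htm, fun g hg hg0 hmid hint => ?_⟩
  have hsD : ∀ x ∈ D, σ x * s x ≤ 0 := fun x hx => by
    simp only [hD, mem_ofPred_eq] at hx
    split_ifs at hx with h <;> rcases hσval x with h' | h' <;> rw [h'] at hx ⊢ <;>
      first | exact absurd rfl hx | linarith
  set A : 𝒳 → ℝ := D.indicator fun x => g (σ x * s x) - g 0 with hA
  have hAm : Measurable A := ((hg.comp (hσ.mul hs)).sub_const _).indicator hDm
  have hA0 : ∀ x, 0 ≤ A x := fun x => indicator_nonneg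
    (fun x hx => sub_nonneg.2 (hg0 _ (hsD x hx))) x
  have hAint : Integrable (fun ω => A (X ω)) μ := by
    have h := ((integrable_comp_of_forall_sign hX hYval hg hint (hσ.mul hs)).sub
      (integrable_const (g 0))).indicator (hX hDm)
    exact h
  have hZint : ∀ f : 𝒳 → ℝ, Measurable f → Integrable (fun ω => f (X ω)) μ →
      Integrable (fun ω => Y ω * σ (X ω) * f (X ω)) μ := fun f hf hfint => by
    refine hfint.mono ((hY.mul (hσ.comp hX)).mul (hf.comp hX)).aestronglyMeasurable
      (ae_of_all _ fun ω => ?_)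
    rcases hYval ω with h | h <;> rcases hσval (X ω) with h' | h' <;> simp [h, h']
  have h1m : Measurable (D.indicator (1 : 𝒳 → ℝ)) := measurable_one.indicator hDm
  have h1int : Integrable (fun ω => D.indicator (1 : 𝒳 → ℝ) (X ω)) μ :=
    (integrable_const (1 : ℝ)).indicator (hX hDm)
  have hpt : ∀ ω, g (Y ω * (if X ω ∈ D then δ * σ (X ω) else s (X ω))) +
      (Y ω * σ (X ω) * A (X ω) + ((2 * g 0 - g δ - g (-δ)) / 2 +
        Y ω * σ (X ω) * D.indicator (1 : 𝒳 → ℝ) (X ω) * ((g (-δ) - g δ) / 2))) ≤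
      g (Y ω * s (X ω)) := fun ω => by
    have h2 := hmid δ
    by_cases hω : X ω ∈ D
    · have h3 := hmid (s (X ω))
      rcases hYval ω with h | h <;> rcases hσval (X ω) with h' | h' <;>
        simp only [hA, indicator_of_mem hω, if_pos hω, h, h', Pi.one_apply, mul_one, one_mul,
          mul_neg, neg_mul, neg_neg] <;> linarith
    · simp only [hA, indicator_of_notMem hω, if_neg hω]
      linarith
  have i1 := hZint A hAm hAint
  have i2 := hZint _ h1m h1int
  have i3 := (i2.mul_const ((g (-δ) - g δ) / 2))
  have i4 : Integrable (fun ω => (2 * g 0 - g δ - g (-δ)) / 2 +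
      Y ω * σ (X ω) * D.indicator (1 : 𝒳 → ℝ) (X ω) * ((g (-δ) - g δ) / 2)) μ :=
    (integrable_const _).add i3
  have i5 : Integrable (fun ω => Y ω * σ (X ω) * A (X ω) + ((2 * g 0 - g δ - g (-δ)) / 2 +
      Y ω * σ (X ω) * D.indicator (1 : 𝒳 → ℝ) (X ω) * ((g (-δ) - g δ) / 2))) μ := i1.add i4
  have hmono := integral_mono ((hint _ htm).add i5) (hint s hs) hpt
  simp only [Pi.add_apply] at hmono
  rw [integral_add (hint _ htm) i5, integral_add i1 i4, integral_add (integrable_const _) i3,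
    integral_mul_const] at hmono
  simp only [integral_const, probReal_univ, one_smul] at hmono
  linarith [hbayes A hAm hA0 hAint]

end Bayes

/-- Unavoidable collapse under OCE criteria, sequential version: any sequence
of measurable scores minimizing the OCE surrogate criterion over the class of
all measurable scores has error probabilities converging to the optimal error
probability. -/
theorem oce_surrogate_minimizing_sequence_err_tendsto
    {Ω 𝒳 : Type*} [MeasurableSpace Ω] [MeasurableSpace 𝒳]
    (μ : Measure Ω) [IsProbabilityMeasure μ]
    (X : Ω → 𝒳) (hX : Measurable X)
    (Y : Ω → ℝ) (hY : Measurable Y) (hYval : ∀ ω : Ω, Y ω = 1 ∨ Y ω = -1)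
    (φ : ℝ → ℝ) (hφ_nonneg : ∀ u : ℝ, 0 ≤ φ u) (hφ_conv : ConvexOn ℝ Set.univ φ)
    (φ'0 : ℝ) (hφ_deriv : HasDerivAt φ φ'0 0) (hφ'0 : φ'0 < 0)
    (ρ : ℝ → ℝ) (hρ_conv : ConvexOn ℝ Set.univ ρ) (hρ_diff : Differentiable ℝ ρ)
    (hρ_mono : StrictMono ρ) (hρ₀ : ρ 0 = 0) (hρ'₀ : deriv ρ 0 = 1)
    (hInt : ∀ s : 𝒳 → ℝ, Measurable s → ∀ θ : ℝ,
      Integrable (fun ω => ρ (φ (Y ω * s (X ω)) - θ)) μ)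
    (OCE : (𝒳 → ℝ) → ℝ)
    (hOCE : ∀ s : 𝒳 → ℝ,
      OCE s = ⨅ θ : ℝ, θ + ∫ ω, ρ (φ (Y ω * s (X ω)) - θ) ∂μ)
    (hattain : ∀ s : 𝒳 → ℝ, Measurable s → ∃ θ₀ : ℝ,
      θ₀ + ∫ ω, ρ (φ (Y ω * s (X ω)) - θ₀) ∂μ = OCE s)
    (Err : (𝒳 → ℝ) → ℝ)
    (hErr : ∀ s : 𝒳 → ℝ,
      Err s = (μ {ω | (if 0 ≤ s (X ω) then (1 : ℝ) else -1) ≠ Y ω}).toReal)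
    (s : ℕ → 𝒳 → ℝ) (hs : ∀ n : ℕ, Measurable (s n))
    (hmin : Tendsto (fun n => OCE (s n)) atTop
      (𝓝 (sInf {v : ℝ | ∃ t : 𝒳 → ℝ, Measurable t ∧ v = OCE t}))) :
    Tendsto (fun n => Err (s n)) atTop
      (𝓝 (sInf {v : ℝ | ∃ t : 𝒳 → ℝ, Measurable t ∧ v = Err t})) := by
  have hle : ∀ x, x ≤ ρ x := fun x => by
    have h := hρ_conv.add_mul_sub_le_of_hasDerivAt (hρ_diff 0).hasDerivAt x
    rw [hρ₀, hρ'₀] at h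
    linarith
  have hφ_cont : Continuous φ := continuousOn_univ.1 (hφ_conv.continuousOn isOpen_univ)
  have hcost : ∀ t : 𝒳 → ℝ, Measurable t → ∀ θ : ℝ,
      θ + ρ (-θ) ≤ θ + ∫ ω, ρ (φ (Y ω * t (X ω)) - θ) ∂μ := fun t ht θ => by
    have h := integral_mono (integrable_const (μ := μ) (ρ (-θ))) (hInt t ht θ)
      fun ω => hρ_mono.monotone (by linarith [hφ_nonneg (Y ω * t (X ω))])
    simp only [integral_const, probReal_univ, one_smul] at h
    linarith
  have hOCE_le : ∀ t : 𝒳 → ℝ, Measurable t → ∀ θ : ℝ,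
      OCE t ≤ θ + ∫ ω, ρ (φ (Y ω * t (X ω)) - θ) ∂μ := fun t ht θ => by
    rw [hOCE]
    refine ciInf_le ⟨0, ?_⟩ θ
    rintro _ ⟨θ, rfl⟩
    linarith [hcost t ht θ, hle (-θ)]
  have hOCE_nonneg : ∀ t : 𝒳 → ℝ, Measurable t → 0 ≤ OCE t := fun t ht => by
    obtain ⟨θ, hθ⟩ := hattain t ht
    linarith [hcost t ht θ, hle (-θ)]
  have hattain_nonneg : ∀ t : 𝒳 → ℝ, Measurable t → ∃ θ ≥ 0,
      θ + ∫ ω, ρ (φ (Y ω * t (X ω)) - θ) ∂μ = OCE t := fun t ht => by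
    obtain ⟨θ, hθ⟩ := hattain t ht
    rcases le_total 0 θ with h0 | h0
    · exact ⟨θ, h0, hθ⟩
    · refine ⟨0, le_rfl, le_antisymm ?_ (hOCE_le t ht 0)⟩
      rw [← hθ]
      have h := integral_mono ((integrable_const (μ := μ) (-θ)).add (hInt t ht 0)) (hInt t ht θ)
        fun ω => by
          have hL := hφ_nonneg (Y ω * t (X ω))
          have h1 := hρ_conv.add_mul_sub_le_of_hasDerivAt
            (hρ_diff (φ (Y ω * t (X ω)))).hasDerivAt (φ (Y ω * t (X ω)) - θ)
          have h2 : 1 ≤ deriv ρ (φ (Y ω * t (X ω))) := hρ'₀ ▸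
            hρ_conv.monotoneOn_deriv (fun x _ => hρ_diff x) (mem_univ _) (mem_univ _) hL
          simp only [Pi.add_apply, sub_zero]
          nlinarith
      simp only [Pi.add_apply] at h
      rw [integral_add (integrable_const _) (hInt t ht 0)] at h
      simp only [integral_const, probReal_univ, one_smul] at h
      linarith
  obtain ⟨σ, hσ, hσval, hbayes⟩ := exists_bayes_sign (μ := μ) hX hY hYval
  have hsign : ∀ x, (if 0 ≤ σ x then (1 : ℝ) else -1) = σ x := fun x => by
    rcases hσval x with h | h <;> norm_num [h]
  have hexcess : ∀ t : 𝒳 → ℝ, Measurable t → Err t - Err σ = ∫ ω, Y ω * σ (X ω) *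
      {x | (if 0 ≤ t x then (1 : ℝ) else -1) ≠ σ x}.indicator 1 (X ω) ∂μ := fun t ht => by
    rw [hErr, hErr, ← measure_ne_sub_measure_ne hX hY hYval (measurable_ite_nonneg ht)
      (fun x => by split_ifs <;> simp) hσ hσval]
    simp only [hsign]
  have hErr_min : ∀ t : 𝒳 → ℝ, Measurable t → Err σ ≤ Err t := fun t ht => by
    have hD : MeasurableSet {x | (if 0 ≤ t x then (1 : ℝ) else -1) ≠ σ x} :=
      (measurableSet_eq_fun (measurable_ite_nonneg ht) hσ).compl
    rw [← sub_nonneg, hexcess t ht]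
    exact hbayes _ (measurable_one.indicator hD) (indicator_nonneg fun _ _ => zero_le_one)
      ((integrable_const (1 : ℝ)).indicator (hX hD))
  have hErr_sInf : sInf {v : ℝ | ∃ t : 𝒳 → ℝ, Measurable t ∧ v = Err t} = Err σ :=
    IsLeast.csInf_eq ⟨⟨σ, hσ, rfl⟩, by rintro _ ⟨t, ht, rfl⟩; exact hErr_min t ht⟩
  rw [hErr_sInf]
  set I := sInf {v : ℝ | ∃ t : 𝒳 → ℝ, Measurable t ∧ v = OCE t} with hI
  have hI_le : ∀ t : 𝒳 → ℝ, Measurable t → I ≤ OCE t := fun t ht =>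
    csInf_le ⟨0, by rintro _ ⟨t, ht, rfl⟩; exact hOCE_nonneg t ht⟩ ⟨t, ht, rfl⟩
  refine tendsto_order.2 ⟨fun b hb => .of_forall fun n => hb.trans_le (hErr_min _ (hs n)),
    fun b hb => ?_⟩
  set ε := min (b - Err σ) 1 with hε_def
  have hε : 0 < ε := lt_min (sub_pos.2 hb) one_pos
  obtain ⟨δ, -, κ, hκ, hgap⟩ := exists_uniform_margin_gap (hφ_nonneg 0) hφ_conv hφ_deriv hφ'0
    hρ_conv hρ_diff hρ_mono hρ₀ hle (I + 1) hε (min_le_right _ _)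
  filter_upwards [hmin.eventually_lt_const (show I < I + min κ 1 by
    have := lt_min hκ one_pos
    linarith)] with n hn
  by_contra! hbn
  obtain ⟨θ, hθ0, hθ⟩ := hattain_nonneg (s n) (hs n)
  have hM : θ + ρ (-θ) ≤ I + 1 := by
    linarith [hcost (s n) (hs n) θ, min_le_right κ 1]
  have hgap := hgap θ hθ0 hM
  obtain ⟨t, ht, himp⟩ := exists_improved_score hX hY hYval hσ hσval hbayes (hs n) δ
  have hg_conv := hφ_conv.comp_sub_const hρ_conv hρ_mono.monotone θ
  have himp := himp (fun u => ρ (φ u - θ))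
    (hρ_diff.continuous.comp (hφ_cont.sub continuous_const)).measurable
    (fun v hv => hρ_mono.monotone (by
      have := hφ_conv.add_mul_sub_le_of_hasDerivAt hφ_deriv v
      nlinarith))
    hg_conv.two_mul_apply_zero_le (fun t ht => hInt t ht θ)
  have hmid := hg_conv.two_mul_apply_zero_le δ
  beta_reduce at himp hmid
  rw [← hexcess _ (hs n)] at himp
  have hεn : ε ≤ Err (s n) - Err σ := (min_le_left _ _).trans (by linarith)
  have hnonneg : 0 ≤ ρ (φ (-δ) - θ) - ρ (φ δ - θ) := by nlinarith
  have hmul := mul_le_mul_of_nonneg_right hεn (div_nonneg hnonneg zero_le_two)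
  have hκle : κ ≤ (2 * ρ (φ 0 - θ) - ρ (φ δ - θ) - ρ (φ (-δ) - θ)) / 2 +
      ε * ((ρ (φ (-δ) - θ) - ρ (φ δ - θ)) / 2) := by
    nlinarith
  linarith [hI_le t ht, hOCE_le t ht θ, min_le_left κ 1]
end
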